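/- arXiv:2501.04482 — 2 statements merged into one kernel-verified Lean document; each statement's English description precedes it below -/
import Mathlib

section
/- If an orthoset X is atomistic, then the complete lattice C(X) of its orthoclosed subsets is atomistic: every orthoclosed set is the join (double orthocomplement of the union) of the atoms below it, the atoms of C(X) being exactly the sets {x}⊥⊥ for proper x ∈ X. -/
/-- An orthoset (with 0). -/
structure OrthoRel (X : Type*) where
  perp : X → X → Prop
  zero : X
  symm : ∀ x y, perp x y → perp y x
  perp_self_iff : ∀ x, perp x x ↔ x = zero
  zero_perp : ∀ x, perp zero x

/-- Orthocomplement of a set with respect to a relation. -/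
def ocl {X : Type*} (p : X → X → Prop) (A : Set X) : Set X := {x | ∀ y ∈ A, p x y}

/-- A set is orthoclosed if it equals its double orthocomplement. -/
def IsOrthoclosed {X : Type*} (p : X → X → Prop) (A : Set X) : Prop :=
  A = ocl p (ocl p A)

/-- `X` is atomistic. -/
def Atomistic {X : Type*} (O : OrthoRel X) : Prop :=
  ∀ x y : X, x ≠ O.zero → y ≠ O.zero →
    (∃ z, O.perp z x ∧ ¬ O.perp z y) → ∃ z', O.perp z' y ∧ ¬ O.perp z' x

/-- An atom of the complete lattice `C(X)` of orthoclosed sets (whose bottom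
element is `{0}`): a minimal orthoclosed set distinct from `{0}`. -/
def IsAtomC {X : Type*} (O : OrthoRel X) (B : Set X) : Prop :=
  IsOrthoclosed O.perp B ∧ B ≠ {O.zero} ∧
    ∀ C : Set X, IsOrthoclosed O.perp C → C ⊆ B → C = {O.zero} ∨ C = B

section Orthoclosure

variable {X : Type*} (O : OrthoRel X)

theorem ocl_antitone (p : X → X → Prop) {A B : Set X} (hAB : A ⊆ B) : ocl p B ⊆ ocl p A :=
  fun _ hx y hy => hx y (hAB hy)

theorem OrthoRel.subset_ocl_ocl (A : Set X) : A ⊆ ocl O.perp (ocl O.perp A) :=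
  fun x hx y hy => O.symm y x (hy x hx)

theorem OrthoRel.isOrthoclosed_ocl (A : Set X) : IsOrthoclosed O.perp (ocl O.perp A) :=
  Set.Subset.antisymm (O.subset_ocl_ocl _) (ocl_antitone _ (O.subset_ocl_ocl A))

variable {O}

theorem IsOrthoclosed.ocl_ocl_subset {A B : Set X} (hB : IsOrthoclosed O.perp B) (hAB : A ⊆ B) :
    ocl O.perp (ocl O.perp A) ⊆ B := by
  conv_rhs => rw [hB]
  exact ocl_antitone _ (ocl_antitone _ hAB)

theorem IsOrthoclosed.zero_mem {A : Set X} (hA : IsOrthoclosed O.perp A) : O.zero ∈ A := by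
  rw [hA]
  exact fun y _ => O.zero_perp y

theorem IsOrthoclosed.exists_proper_mem {A : Set X} (hA : IsOrthoclosed O.perp A)
    (hne : A ≠ {O.zero}) : ∃ x ∈ A, x ≠ O.zero := by
  by_contra! hall
  exact hne (Set.Subset.antisymm hall (Set.singleton_subset_iff.2 hA.zero_mem))

theorem mem_ocl_ocl_self (O : OrthoRel X) (x : X) : x ∈ ocl O.perp (ocl O.perp {x}) :=
  O.subset_ocl_ocl {x} rfl

theorem ocl_ocl_singleton_ne {x : X} (hx : x ≠ O.zero) :
    ocl O.perp (ocl O.perp {x}) ≠ {O.zero} := by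
  intro heq
  have hmem := mem_ocl_ocl_self O x
  rw [heq] at hmem
  exact hx hmem

/-- In an atomistic orthoset, membership in the closure of a proper element is symmetric. -/
theorem Atomistic.mem_ocl_ocl_comm (h : Atomistic O) {x y : X} (hx : x ≠ O.zero)
    (hy : y ≠ O.zero) (hyx : y ∈ ocl O.perp (ocl O.perp {x})) :
    x ∈ ocl O.perp (ocl O.perp {y}) := by
  intro z hz
  by_contra hxz
  obtain ⟨w, hwx, hwy⟩ := h y x hy hx ⟨z, hz y rfl, fun hzx => hxz (O.symm _ _ hzx)⟩
  refine hwy (O.symm _ _ (hyx w ?_))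
  rintro _ rfl
  exact hwx

theorem Atomistic.isAtomC_ocl_ocl_singleton (h : Atomistic O) {x : X} (hx : x ≠ O.zero) :
    IsAtomC O (ocl O.perp (ocl O.perp {x})) := by
  refine ⟨O.isOrthoclosed_ocl _, ocl_ocl_singleton_ne hx, fun C hC hCx => ?_⟩
  by_cases hne : C = {O.zero}
  · exact Or.inl hne
  · obtain ⟨y, hyC, hy⟩ := hC.exists_proper_mem hne
    have hxC : x ∈ C := hC.ocl_ocl_subset (Set.singleton_subset_iff.2 hyC)
      (h.mem_ocl_ocl_comm hx hy (hCx hyC))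
    exact Or.inr (hCx.antisymm (hC.ocl_ocl_subset (Set.singleton_subset_iff.2 hxC)))

theorem IsAtomC.exists_eq_ocl_ocl_singleton {B : Set X} (hB : IsAtomC O B) :
    ∃ x : X, x ≠ O.zero ∧ B = ocl O.perp (ocl O.perp {x}) := by
  obtain ⟨hclosed, hne, hmin⟩ := hB
  obtain ⟨x, hxB, hx⟩ := hclosed.exists_proper_mem hne
  refine ⟨x, hx, ?_⟩
  rcases hmin _ (O.isOrthoclosed_ocl _)
    (hclosed.ocl_ocl_subset (Set.singleton_subset_iff.2 hxB)) with heq | heq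
  · exact absurd heq (ocl_ocl_singleton_ne hx)
  · exact heq.symm

end Orthoclosure

/-- Lemma 2.8 (first part): if `X` is an atomistic orthoset, then `C(X)` is
atomistic: every orthoclosed set is the join of the atoms below it, and the atoms
of `C(X)` are exactly the sets `{x}⊥⊥` for proper `x ∈ X`. -/
theorem stmt4 {X : Type*} (O : OrthoRel X) (h : Atomistic O) :
    (∀ A : Set X, IsOrthoclosed O.perp A →
      A = ocl O.perp (ocl O.perp (⋃₀ {B : Set X | IsAtomC O B ∧ B ⊆ A}))) ∧
    (∀ B : Set X, IsAtomC O B ↔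
      ∃ x : X, x ≠ O.zero ∧ B = ocl O.perp (ocl O.perp {x})) := by
  refine ⟨fun A hA => Set.Subset.antisymm (fun x hxA => ?_)
    (hA.ocl_ocl_subset (Set.sUnion_subset fun B hB => hB.2)), fun B => ⟨fun hB =>
      hB.exists_eq_ocl_ocl_singleton, ?_⟩⟩
  · by_cases hx : x = O.zero
    · rw [hx]
      exact (O.isOrthoclosed_ocl _).zero_mem
    · exact O.subset_ocl_ocl _ ⟨_, ⟨h.isAtomC_ocl_ocl_singleton hx,
        hA.ocl_ocl_subset (Set.singleton_subset_iff.2 hxA)⟩, mem_ocl_ocl_self O x⟩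
  · rintro ⟨x, hx, rfl⟩
    exact h.isAtomC_ocl_ocl_singleton hx
end

section
/- Let X be an orthoset and f : X → X an adjointable map. (1) If f ∥ id_X (i.e., {f(x)}⊥ = {x}⊥ for all x), then f is scalar. (2) Conversely, if X is atomistic and irreducible, and f is scalar and not constantly 0, then f ∥ id_X. -/
/-- `g` is an adjoint of `f`: `f(x) ⊥ y` iff `x ⊥ g(y)`. -/
def IsAdjointPair {X Y : Type*} (pX : X → X → Prop) (pY : Y → Y → Prop)
    (f : X → Y) (g : Y → X) : Prop :=
  ∀ x y, pY (f x) y ↔ pX x (g y)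

/-- `X` is irreducible: no decomposition `(A, A⊥)` into nonzero subspaces with
`A ∪ A⊥ = X`. -/
def Irreducible' {X : Type*} (O : OrthoRel X) : Prop :=
  ¬ ∃ A : Set X, IsOrthoclosed O.perp A ∧ A ≠ {O.zero} ∧ ocl O.perp A ≠ {O.zero} ∧
      A ∪ ocl O.perp A = Set.univ

/-- `f` is scalar: every orthoclosed set together with its orthocomplement is
invariant under `f`. -/
def Scalar {X : Type*} (O : OrthoRel X) (f : X → X) : Prop :=
  ∀ A : Set X, IsOrthoclosed O.perp A → f '' A ⊆ A ∧ f '' ocl O.perp A ⊆ ocl O.perp A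

namespace OrthoRel

variable {X : Type*} (O : OrthoRel X)

lemma perp_comm (x y : X) : O.perp x y ↔ O.perp y x := ⟨O.symm x y, O.symm y x⟩

lemma perp_zero (x : X) : O.perp x O.zero := O.symm _ _ (O.zero_perp x)

lemma ocl_singleton_eq_iff (x y : X) :
    ocl O.perp {x} = ocl O.perp {y} ↔ ∀ z, O.perp z x ↔ O.perp z y := by
  simp [ocl, Set.ext_iff]

lemma subset_ocl_ocl_s15 (A : Set X) : A ⊆ ocl O.perp (ocl O.perp A) :=
  fun x hx _ hy => O.symm _ _ (hy x hx)

lemma isOrthoclosed_ocl_s15 (A : Set X) : IsOrthoclosed O.perp (ocl O.perp A) :=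
  Set.Subset.antisymm (O.subset_ocl_ocl_s15 _) fun _ hx _ hy => hx _ (O.subset_ocl_ocl_s15 A hy)

variable {O} {f g : X → X}

lemma map_mem_ocl (h : ∀ x z, O.perp z (f x) ↔ O.perp z x) {A : Set X} {x : X}
    (hx : x ∈ ocl O.perp A) : f x ∈ ocl O.perp A :=
  fun y hy => O.symm _ _ ((h x y).2 (O.symm _ _ (hx y hy)))

lemma scalar_of_parallel (h : ∀ x z, O.perp z (f x) ↔ O.perp z x) : Scalar O f := by
  intro A hA
  constructor
  · rintro _ ⟨x, hx, rfl⟩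
    rw [hA] at hx ⊢
    exact map_mem_ocl h hx
  · rintro _ ⟨x, hx, rfl⟩
    exact map_mem_ocl h hx

lemma map_zero_of_adjoint (hfg : IsAdjointPair O.perp O.perp f g) : f O.zero = O.zero :=
  (O.perp_self_iff _).1 ((hfg _ _).2 (O.zero_perp _))

lemma _root_.Scalar.perp_map (hs : Scalar O f) {x z : X} (hz : O.perp z x) :
    O.perp z (f x) := by
  have h := (hs _ (O.isOrthoclosed_ocl_s15 {z})).1
  have hx : x ∈ ocl O.perp {z} := by simpa [ocl] using O.symm _ _ hz
  have hfx : f x ∈ ocl O.perp {z} := h ⟨x, hx, rfl⟩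
  exact O.symm _ _ (hfx z rfl)

lemma _root_.Scalar.perp_map_iff (hs : Scalar O f) (ha : Atomistic O)
    (hfg : IsAdjointPair O.perp O.perp f g) {x : X} (hx : f x ≠ O.zero) (z : X) :
    O.perp z (f x) ↔ O.perp z x := by
  refine ⟨fun h => ?_, hs.perp_map⟩
  by_contra hzx
  have hx0 : x ≠ O.zero := by
    rintro rfl
    exact hx (map_zero_of_adjoint hfg)
  obtain ⟨w, hw, hw'⟩ := ha _ _ hx hx0 ⟨z, h, hzx⟩
  exact hw' (hs.perp_map hw)

lemma ker_eq_ocl_range (hfg : IsAdjointPair O.perp O.perp f g) :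
    {x | f x = O.zero} = ocl O.perp (Set.range g) := by
  ext x
  constructor
  · rintro (hx : f x = O.zero) _ ⟨y, rfl⟩
    rw [← hfg, hx]
    exact O.zero_perp y
  · intro hx
    exact (O.perp_self_iff _).1 ((hfg _ _).2 (hx _ ⟨_, rfl⟩))

lemma _root_.Scalar.adjoint_eq_zero (hs : Scalar O f) (ha : Atomistic O)
    (hfg : IsAdjointPair O.perp O.perp f g) {y : X} (hy : f y = O.zero) : g y = O.zero := by
  rw [← O.perp_self_iff, ← hfg]
  by_cases h : f (g y) = O.zero
  · rw [h]
    exact O.zero_perp y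
  · rw [O.perp_comm, hs.perp_map_iff ha hfg h, ← hfg, hy]
    exact O.zero_perp y

lemma _root_.Scalar.ker_union_ocl_ker (hs : Scalar O f) (ha : Atomistic O)
    (hfg : IsAdjointPair O.perp O.perp f g) :
    {x | f x = O.zero} ∪ ocl O.perp {x | f x = O.zero} = Set.univ := by
  refine Set.eq_univ_of_forall fun x => or_iff_not_imp_left.2 fun hx y hy => ?_
  rw [O.perp_comm, ← hs.perp_map_iff ha hfg hx, O.perp_comm, hfg,
    hs.adjoint_eq_zero ha hfg hy]
  exact O.perp_zero x

lemma _root_.Scalar.ker_eq_singleton_zero (hs : Scalar O f) (ha : Atomistic O)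
    (hi : Irreducible' O) (hfg : IsAdjointPair O.perp O.perp f g)
    (h0 : ¬ ∀ x, f x = O.zero) : {x | f x = O.zero} = {O.zero} := by
  have hu := hs.ker_union_ocl_ker ha hfg
  by_contra hK
  refine hi ⟨_, ?_, hK, fun hK' => h0 fun x => ?_, hu⟩
  · rw [ker_eq_ocl_range hfg]
    exact O.isOrthoclosed_ocl_s15 _
  · rw [hK'] at hu
    rcases hu.ge (Set.mem_univ x) with hx | rfl
    · exact hx
    · exact map_zero_of_adjoint hfg

end OrthoRel

/-- Lemma 3.12: an adjointable `f : X → X` with `f ∥ id` is scalar; conversely,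
if `X` is atomistic and irreducible and `f` is scalar and not constantly `0`,
then `f ∥ id`. -/
theorem stmt15 {X : Type*} (O : OrthoRel X) (f : X → X)
    (hf : ∃ g : X → X, IsAdjointPair O.perp O.perp f g) :
    ((∀ x : X, ocl O.perp {f x} = ocl O.perp {x}) → Scalar O f) ∧
    (Atomistic O → Irreducible' O → Scalar O f → (¬ ∀ x : X, f x = O.zero) →
      ∀ x : X, ocl O.perp {f x} = ocl O.perp {x}) := by
  simp only [O.ocl_singleton_eq_iff]
  obtain ⟨g, hfg⟩ := hf
  refine ⟨OrthoRel.scalar_of_parallel, fun ha hi hs h0 x => ?_⟩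
  by_cases hx : f x = O.zero
  · have hx0 : x = O.zero := (hs.ker_eq_singleton_zero ha hi hfg h0).le hx
    simp [hx0, OrthoRel.map_zero_of_adjoint hfg]
  · exact hs.perp_map_iff ha hfg hx
end
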